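/- (Relativistic Hamilton–Jacobi equation implies the Dirac–Hestenes equation for classical spinor fields.) Let m > 0, e ∈ ℝ, and let Π, A ∈ ℝ⁴ be constant covectors satisfying the relativistic Hamilton–Jacobi equation Σ_{μ,ν} η^{μν}(Π_μ + eA_μ)(Π_ν + eA_ν) = m² and m + Π₀ + eA₀ > 0. Set P = Σ_μ (Π_μ + eA_μ) γ^μ, define the rotor R = (m + Pγ⁰) / √(2m(m + Π₀ + eA₀)), the phase S(x) = −Σ_μ Π_μ x^μ, and the classical spinor field ψ(x) = R · e^{S(x)γ21}. Then ψ satisfies the Dirac–Hestenes equation: Σ_μ γ^μ (∂_μ ψ)(x) γ21 − m ψ(x) γ⁰ + e (Σ_μ A_μ γ^μ) ψ(x) = 0 for all x ∈ ℝ⁴. -/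

import Mathlib

noncomputable section
open CliffordAlgebra

/-- The Minkowski quadratic form `Q(x) = x₀² - x₁² - x₂² - x₃²` on `ℝ⁴`. -/
def Qmink : QuadraticForm ℝ (Fin 4 → ℝ) :=
  QuadraticMap.weightedSumSquares ℝ ![(1 : ℝ), -1, -1, -1]

/-- The spacetime algebra `ℝ_{1,3}`. -/
abbrev STA : Type := CliffordAlgebra Qmink

/-- The generating vectors `γ_μ = ι(e_μ)`. -/
def γ (μ : Fin 4) : STA := ι Qmink (Pi.single μ 1)

/-- The signs `η^{μμ} = diag(1,-1,-1,-1)`. -/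
def ηsgn (μ : Fin 4) : ℝ := if μ = 0 then 1 else -1

/-- The raised-index vectors `γ^μ := η^{μμ} γ_μ`. -/
def γup (μ : Fin 4) : STA := ηsgn μ • γ μ

/-- The bivector `γ21 := γ₂γ₁` (it squares to `-1`). -/
def γ21 : STA := γ 2 * γ 1

/-- `e^{θ γ21} := cos θ + (sin θ) γ21`. -/
def expG21 (θ : ℝ) : STA := algebraMap ℝ STA (Real.cos θ) + Real.sin θ • γ21

/-- The partial derivative `∂_μ f` of a function `f : ℝ⁴ → ℝ` at `x`. -/
def pd (μ : Fin 4) (f : (Fin 4 → ℝ) → ℝ) (x : Fin 4 → ℝ) : ℝ :=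
  deriv (fun t : ℝ => f (x + t • (Pi.single μ 1 : Fin 4 → ℝ))) 0

/-- `f' ` is the `μ`-th partial derivative of the spacetime-algebra valued field `f`
(tested against all real-linear functionals, since `STA` carries no topology). -/
def HasPDeriv (μ : Fin 4) (f f' : (Fin 4 → ℝ) → STA) : Prop :=
  ∀ (L : STA →ₗ[ℝ] ℝ) (x : Fin 4 → ℝ),
    HasDerivAt (fun t : ℝ => L (f (x + t • (Pi.single μ 1 : Fin 4 → ℝ)))) (L (f' x)) 0

/-- The Minkowski metric matrix `η^{μν} = diag(1,-1,-1,-1)`. -/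
def ηm (μ ν : Fin 4) : ℝ := if μ = ν then (if μ = 0 then 1 else -1) else 0

theorem Qmink_apply (v : Fin 4 → ℝ) :
    Qmink v = v 0 ^ 2 - v 1 ^ 2 - v 2 ^ 2 - v 3 ^ 2 := by
  simp [Qmink, QuadraticMap.weightedSumSquares_apply, Fin.sum_univ_four]
  ring

theorem γ_mul_self (μ : Fin 4) : γ μ * γ μ = algebraMap ℝ STA (ηsgn μ) := by
  rw [γ, ι_sq_scalar, Qmink_apply]
  congr 1
  fin_cases μ <;> simp [ηsgn]

theorem γ_mul_γ_of_ne {μ ν : Fin 4} (h : μ ≠ ν) : γ μ * γ ν = -(γ ν * γ μ) := by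
  refine ι_mul_ι_comm_of_isOrtho (QuadraticMap.isOrtho_def.mpr ?_)
  simp only [Qmink_apply]
  fin_cases μ <;> fin_cases ν <;> simp at h ⊢ <;> ring

theorem γ21_mul_self : γ21 * γ21 = -1 := by
  have h1 := γ_mul_self 1
  have h2 := γ_mul_self 2
  simp only [ηsgn, one_ne_zero, Fin.reduceEq, if_false, map_neg, map_one] at h1 h2
  calc γ 2 * γ 1 * (γ 2 * γ 1) = γ 2 * (γ 1 * γ 2) * γ 1 := by simp only [mul_assoc]
    _ = -(γ 2 * γ 2 * (γ 1 * γ 1)) := by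
      rw [γ_mul_γ_of_ne (show (1 : Fin 4) ≠ 2 by decide)]
      simp only [mul_neg, neg_mul, mul_assoc]
    _ = -1 := by rw [h1, h2]; simp

theorem commute_γ21_γ_zero : Commute γ21 (γ 0) := by
  change γ 2 * γ 1 * γ 0 = γ 0 * (γ 2 * γ 1)
  rw [mul_assoc, γ_mul_γ_of_ne (show (1 : Fin 4) ≠ 0 by decide), mul_neg, ← mul_assoc,
    γ_mul_γ_of_ne (show (2 : Fin 4) ≠ 0 by decide), neg_mul, neg_neg, mul_assoc]

theorem commute_expG21_γ_zero (θ : ℝ) : Commute (expG21 θ) (γ 0) :=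
  (Algebra.commute_algebraMap_left _ _).add_left (commute_γ21_γ_zero.smul_left _)

theorem γ21_mul_expG21_mul_γ21 (θ : ℝ) : γ21 * expG21 θ * γ21 = -expG21 θ := by
  have h : Commute γ21 (expG21 θ) :=
    (Algebra.commute_algebraMap_right _ _).add_right ((Commute.refl γ21).smul_right _)
  rw [h.eq, mul_assoc, γ21_mul_self, mul_neg, mul_one]

theorem sum_smul_γup (p : Fin 4 → ℝ) :
    ∑ μ, p μ • γup μ = ι Qmink (fun μ => p μ * ηsgn μ) := by
  rw [← LinearMap.sum_single_apply (φ := fun _ => ℝ) (fun μ => p μ * ηsgn μ), map_sum]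
  refine Finset.sum_congr rfl fun μ _ => ?_
  rw [γup, γ, smul_smul, ← map_smul, ← Pi.single_smul, smul_eq_mul, mul_one]

theorem sum_smul_γup_mul_self (p : Fin 4 → ℝ) :
    (∑ μ, p μ • γup μ) * (∑ μ, p μ • γup μ) =
      algebraMap ℝ STA (∑ μ, ∑ ν, ηm μ ν * p μ * p ν) := by
  rw [sum_smul_γup, ι_sq_scalar, Qmink_apply]
  congr 1
  simp [Fin.sum_univ_four, ηsgn, ηm]
  ring

theorem HasPDeriv.unique {μ : Fin 4} {f f' f'' : (Fin 4 → ℝ) → STA}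
    (h' : HasPDeriv μ f f') (h'' : HasPDeriv μ f f'') : f' = f'' := by
  funext x
  rw [← sub_eq_zero, ← Module.forall_dual_apply_eq_zero_iff ℝ]
  intro L
  rw [map_sub, sub_eq_zero]
  exact (h' L x).unique (h'' L x)

theorem hasPDeriv_mul_expG21 (R : STA) (p : Fin 4 → ℝ) (μ : Fin 4) :
    HasPDeriv μ (fun x => R * expG21 (-∑ ν, p ν * x ν))
      (fun x => -p μ • (R * (γ21 * expG21 (-∑ ν, p ν * x ν)))) := by
  intro L x
  set s : ℝ := -∑ ν, p ν * x ν with hs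
  have hphase (t : ℝ) :
      -∑ ν, p ν * (x + t • (Pi.single μ 1 : Fin 4 → ℝ)) ν = s + t * -p μ := by
    simp [hs, mul_add, Finset.sum_add_distrib, Pi.single_apply]
    ring
  have hL (θ : ℝ) : L (R * expG21 θ) = Real.cos θ * L R + Real.sin θ * L (R * γ21) := by
    rw [expG21, Algebra.algebraMap_eq_smul_one, mul_add, mul_smul_comm, mul_smul_comm, mul_one,
      map_add, map_smul, map_smul, smul_eq_mul, smul_eq_mul]
  have hγ : γ21 * expG21 s = Real.cos s • γ21 - Real.sin s • (1 : STA) := by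
    rw [expG21, Algebra.algebraMap_eq_smul_one, mul_add, mul_smul_comm, mul_smul_comm, mul_one,
      γ21_mul_self, smul_neg, sub_eq_add_neg]
  have hd : HasDerivAt (fun t : ℝ => s + t * -p μ) (-p μ) 0 := by
    simpa using ((hasDerivAt_id (0 : ℝ)).mul_const (-p μ)).const_add s
  simp only [hphase, hL]
  refine ((hd.cos.mul_const (L R)).add (hd.sin.mul_const (L (R * γ21)))).congr_deriv ?_
  simp only [← hs, hγ, mul_sub, mul_smul_comm, mul_one, map_smul, map_sub, smul_eq_mul, zero_mul,
    add_zero]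
  ring

/-- The relativistic Hamilton–Jacobi equation implies the Dirac–Hestenes equation for
classical spinor fields: with constant covectors `Π, A`, `(Π + eA)² = m²` and
`m + Π₀ + eA₀ > 0`, the classical spinor field `ψ(x) = R e^{S(x)γ21}`, with
`R = (m + Pγ⁰)/√(2m(m + Π₀ + eA₀))`, `P = Σ (Π_μ + eA_μ)γ^μ`, `S(x) = -Σ Π_μ x^μ`,
satisfies `∂ψ γ21 - m ψ γ⁰ + e A ψ = 0`. -/
theorem statement4 (m e : ℝ) (hm : 0 < m) (Pi' A : Fin 4 → ℝ)
    (hHJ : ∑ μ, ∑ ν, ηm μ ν * (Pi' μ + e * A μ) * (Pi' ν + e * A ν) = m ^ 2)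
    (hpos : 0 < m + Pi' 0 + e * A 0)
    (P : STA) (hP : P = ∑ μ, (Pi' μ + e * A μ) • γup μ)
    (R : STA)
    (hR : R = (Real.sqrt (2 * m * (m + Pi' 0 + e * A 0)))⁻¹ •
      (algebraMap ℝ STA m + P * γ 0))
    (S : (Fin 4 → ℝ) → ℝ) (hS : S = fun x => -∑ μ, Pi' μ * x μ)
    (ψ : (Fin 4 → ℝ) → STA) (hψ : ψ = fun x => R * expG21 (S x))
    (ψ' : Fin 4 → (Fin 4 → ℝ) → STA) (hψ' : ∀ μ, HasPDeriv μ ψ (ψ' μ))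
    (x : Fin 4 → ℝ) :
    ∑ μ, γup μ * ψ' μ x * γ21 - m • (ψ x * γ 0)
      + e • ((∑ μ, A μ • γup μ) * ψ x) = 0 := by
  have hPP : P * P = algebraMap ℝ STA (m ^ 2) := by
    rw [hP, sum_smul_γup_mul_self fun μ => Pi' μ + e * A μ, hHJ]
  have h0 : γ 0 * γ 0 = 1 := by simp [γ_mul_self, ηsgn]
  have hPR : P * R = m • (R * γ 0) := by
    rw [hR, mul_smul_comm, smul_mul_assoc, smul_comm m, mul_add P, add_mul _ _ (γ 0),
      ← mul_assoc P P, hPP, mul_assoc P, h0]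
    simp only [Algebra.algebraMap_eq_smul_one, mul_smul_comm, smul_mul_assoc, one_mul, mul_one,
      smul_add, smul_smul, pow_two]
    rw [add_comm]
  have hterm (μ : Fin 4) : γup μ * ψ' μ x * γ21 = Pi' μ • (γup μ * ψ x) := by
    have hμ := hψ' μ
    rw [hψ, hS] at hμ
    rw [hμ.unique (hasPDeriv_mul_expG21 R Pi' μ), hψ, hS]
    simp only [mul_smul_comm, smul_mul_assoc]
    rw [mul_assoc, mul_assoc R, γ21_mul_expG21_mul_γ21, mul_neg, mul_neg, smul_neg, neg_smul,
      neg_neg]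
  have hsum : ∑ μ, Pi' μ • (γup μ * ψ x) + e • ((∑ μ, A μ • γup μ) * ψ x) = P * ψ x := by
    rw [hP]
    simp only [Finset.sum_mul, Finset.smul_sum, smul_mul_assoc, smul_smul, add_smul,
      Finset.sum_add_distrib]
    simp only [add_mul, Finset.sum_mul, smul_mul_assoc]
  have hψx : P * ψ x = m • (ψ x * γ 0) := by
    rw [hψ]
    simp only
    rw [← mul_assoc, hPR, mul_assoc R, (commute_expG21_γ_zero _).eq, smul_mul_assoc, mul_assoc R]
  simp only [hterm]
  rw [sub_add_eq_add_sub, hsum, hψx, sub_self]
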